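/- Let 0 < β < α ≤ 2, τ > 0 and r > 0. For c > 0 define K_c(x) := c^{−1} ∫_ℝ |f_{cτ}(x,s)|^α ds for x > 0. Then lim_{c→∞} ∫_0^∞ (e^{−r K_c(x)} − 1) x^{β−1} dx = ∫_0^∞ (e^{−r τ x^{−α}} − 1) x^{β−1} dx = −(Γ(1−β/α)/β) (rτ)^{β/α}. -/

import Mathlib

open MeasureTheory Filter Set

/-- `f_τ(x,s) := ∫_0^τ e^{−x(t−s)} 1(s ≤ t) dt`. -/
noncomputable def fker (τ x s : ℝ) : ℝ :=
  ∫ t in Set.Ioc (0:ℝ) τ, if s ≤ t then Real.exp (-x * (t - s)) else 0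

theorem fker_of_lt {T x s : ℝ} (hs : T < s) : fker T x s = 0 := by
  unfold fker
  refine setIntegral_eq_zero_of_forall_eq_zero fun t ht => ?_
  rw [if_neg (by linarith [ht.2])]

theorem integral_exp_neg_mul_sub (x s a b : ℝ) (hx : x ≠ 0) :
    ∫ t in a..b, Real.exp (-x * (t - s)) =
      (Real.exp (-x * (a - s)) - Real.exp (-x * (b - s))) / x := by
  have h : ∀ t ∈ uIcc a b, HasDerivAt (fun t => -Real.exp (-x * (t - s)) / x)
      (Real.exp (-x * (t - s))) t := by
    intro t _
    have h1 : HasDerivAt (fun t : ℝ => -x * (t - s)) (-x * 1) t :=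
      ((hasDerivAt_id t).sub_const s).const_mul (-x)
    exact (h1.exp.neg.div_const x).congr_deriv (by field_simp)
  rw [intervalIntegral.integral_eq_sub_of_hasDerivAt h
    (Continuous.intervalIntegrable (by fun_prop) _ _)]
  ring

theorem fker_of_nonpos {T x s : ℝ} (hT : 0 ≤ T) (hx : x ≠ 0) (hs : s ≤ 0) :
    fker T x s = (Real.exp (x * s) - Real.exp (-x * (T - s))) / x := by
  unfold fker
  rw [setIntegral_congr_fun (g := fun t => Real.exp (-x * (t - s))) measurableSet_Ioc
    (fun t ht => by simp only [if_pos (hs.trans ht.1.le)]),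
    ← intervalIntegral.integral_of_le hT, integral_exp_neg_mul_sub _ _ _ _ hx]
  congr 3
  ring

theorem fker_of_mem_Ioc {T x s : ℝ} (hx : x ≠ 0) (hs : s ∈ Ioc 0 T) :
    fker T x s = (1 - Real.exp (-x * (T - s))) / x := by
  unfold fker
  have h : ∫ t in Ioc 0 T, (if s ≤ t then Real.exp (-x * (t - s)) else 0) =
      ∫ t in Ioc 0 T, (Icc s T).indicator (fun t => Real.exp (-x * (t - s))) t := by
    refine setIntegral_congr_fun measurableSet_Ioc fun t ht => ?_
    simp only [indicator, mem_Icc, ht.2, and_true]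
  have hsub : Icc s T ⊆ Ioc 0 T := fun t ht => ⟨hs.1.trans_le ht.1, ht.2⟩
  rw [h, setIntegral_indicator measurableSet_Icc, inter_eq_self_of_subset_right hsub,
    integral_Icc_eq_integral_Ioc, ← intervalIntegral.integral_of_le hs.2,
    integral_exp_neg_mul_sub _ _ _ _ hx]
  simp

theorem abs_fker_rpow_le {α T x : ℝ} (hα : 0 < α) (hT : 0 ≤ T) (hx : 0 < x) (s : ℝ) :
    |fker T x s| ^ α ≤ x ^ (-α) * ((Iic 0).indicator (fun s => Real.exp (α * x * s)) s +
      (Ioc 0 T).indicator (fun _ => 1) s) := by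
  rcases lt_or_ge T s with h | h
  · rw [fker_of_lt h, abs_zero, Real.zero_rpow hα.ne']
    refine mul_nonneg (by positivity) (add_nonneg ?_ ?_) <;>
      exact indicator_nonneg (fun _ _ => by positivity) _
  · rw [Real.rpow_neg hx.le]
    rcases le_or_gt s 0 with h0 | h0
    · have hle : Real.exp (-x * (T - s)) ≤ Real.exp (x * s) := Real.exp_le_exp.2 (by nlinarith)
      rw [fker_of_nonpos hT hx.ne' h0, indicator_of_mem (mem_Iic.2 h0),
        indicator_of_notMem (fun hs => h0.not_gt hs.1), add_zero,
        abs_of_nonneg (div_nonneg (sub_nonneg.2 hle) hx.le),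
        Real.div_rpow (sub_nonneg.2 hle) hx.le, div_eq_inv_mul]
      gcongr
      calc _ ≤ (Real.exp (x * s)) ^ α := by
            apply Real.rpow_le_rpow (sub_nonneg.2 hle) _ hα.le
            linarith [Real.exp_pos (-x * (T - s))]
        _ = _ := by rw [← Real.exp_mul]; ring_nf
    · have hle : Real.exp (-x * (T - s)) ≤ 1 := Real.exp_le_one_iff.2 (by nlinarith)
      rw [fker_of_mem_Ioc hx.ne' ⟨h0, h⟩, indicator_of_notMem (show s ∉ Iic 0 from h0.not_ge),
        indicator_of_mem (show s ∈ Ioc 0 T from ⟨h0, h⟩), zero_add,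
        abs_of_nonneg (div_nonneg (sub_nonneg.2 hle) hx.le),
        Real.div_rpow (sub_nonneg.2 hle) hx.le, div_eq_inv_mul]
      gcongr
      exact Real.rpow_le_one (sub_nonneg.2 hle) (by linarith [Real.exp_pos (-x * (T - s))]) hα.le

theorem le_abs_fker_rpow {α T x : ℝ} (hα : 0 < α) (hα2 : α ≤ 2) (hx : 0 < x) (s : ℝ) :
    x ^ (-α) * ((Ioc 0 T).indicator (fun _ => 1) s -
      2 * (Iic T).indicator (fun s => Real.exp (x * s) * Real.exp (-x * T)) s) ≤
      |fker T x s| ^ α := by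
  by_cases hs : s ∈ Ioc 0 T
  · have hle : Real.exp (-x * (T - s)) ≤ 1 := Real.exp_le_one_iff.2 (by nlinarith [hs.2])
    rw [Real.rpow_neg hx.le, fker_of_mem_Ioc hx.ne' hs, indicator_of_mem hs,
      indicator_of_mem (mem_Iic.2 hs.2), abs_of_nonneg (div_nonneg (sub_nonneg.2 hle) hx.le),
      Real.div_rpow (sub_nonneg.2 hle) hx.le, div_eq_inv_mul, ← Real.exp_add,
      show x * s + -x * T = -x * (T - s) by ring]
    gcongr
    have hpos := Real.exp_pos (-x * (T - s))
    generalize Real.exp (-x * (T - s)) = y at *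
    calc 1 - 2 * y ≤ (1 - y) ^ (2 : ℝ) := by rw [Real.rpow_two]; nlinarith
      _ ≤ (1 - y) ^ α := Real.rpow_le_rpow_of_exponent_ge' (by linarith) (by linarith) hα.le hα2
  · rw [indicator_of_notMem hs]
    refine le_trans ?_ (by positivity : (0 : ℝ) ≤ |fker T x s| ^ α)
    have h : 0 ≤ (Iic T).indicator (fun s => Real.exp (x * s) * Real.exp (-x * T)) s :=
      indicator_nonneg (fun _ _ => by positivity) _
    exact mul_nonpos_of_nonneg_of_nonpos (by positivity) (by linarith)

theorem measurable_fker (T : ℝ) : Measurable fun p : ℝ × ℝ => fker T p.1 p.2 := by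
  unfold fker
  refine (StronglyMeasurable.integral_prod_right (ν := volume.restrict (Ioc 0 T))
    (f := fun (p : ℝ × ℝ) t => if p.2 ≤ t then Real.exp (-p.1 * (t - p.2)) else 0)
    (Measurable.stronglyMeasurable ?_)).measurable
  exact Measurable.ite (measurableSet_le (by fun_prop) (by fun_prop)) (by fun_prop) (by fun_prop)

theorem integrable_indicator_one_Ioc (a b : ℝ) :
    Integrable ((Ioc a b).indicator (fun _ => (1 : ℝ))) :=
  (integrable_indicator_iff measurableSet_Ioc).2 (by simp)

theorem integral_indicator_one_Ioc {a b : ℝ} (h : a ≤ b) :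
    ∫ s, (Ioc a b).indicator (fun _ => (1 : ℝ)) s = b - a := by
  rw [integral_indicator measurableSet_Ioc]
  simp [h]

theorem integral_abs_fker_rpow_le {α T x : ℝ} (hα : 0 < α) (hT : 0 ≤ T) (hx : 0 < x) :
    ∫ s, |fker T x s| ^ α ≤ x ^ (-α) * ((α * x)⁻¹ + T) := by
  have hi : Integrable ((Iic 0).indicator fun s => Real.exp (α * x * s)) :=
    (integrable_indicator_iff measurableSet_Iic).2 (integrableOn_exp_mul_Iic (by positivity) 0)
  have hg := hi.add (integrable_indicator_one_Ioc 0 T)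
  refine (integral_mono_of_nonneg (ae_of_all _ fun s => by positivity) (hg.const_mul (x ^ (-α)))
    (ae_of_all _ (abs_fker_rpow_le hα hT hx))).trans_eq ?_
  rw [integral_const_mul]
  simp only [Pi.add_apply]
  rw [integral_add hi (integrable_indicator_one_Ioc 0 T),
    integral_indicator_one_Ioc hT, integral_indicator measurableSet_Iic,
    integral_exp_mul_Iic (by positivity)]
  simp

theorem le_integral_abs_fker_rpow {α T x : ℝ} (hα : 0 < α) (hα2 : α ≤ 2) (hT : 0 ≤ T)
    (hx : 0 < x) : x ^ (-α) * (T - 2 * x⁻¹) ≤ ∫ s, |fker T x s| ^ α := by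
  have hi : Integrable ((Iic 0).indicator fun s => Real.exp (α * x * s)) :=
    (integrable_indicator_iff measurableSet_Iic).2 (integrableOn_exp_mul_Iic (by positivity) 0)
  have hf : Integrable fun s => |fker T x s| ^ α := by
    refine Integrable.mono' ((hi.add (integrable_indicator_one_Ioc 0 T)).const_mul (x ^ (-α)))
      ?_ (ae_of_all _ fun s => ?_)
    · have := (measurable_fker T).comp (measurable_prodMk_left (x := x))
      exact (by fun_prop : Measurable fun s => |fker T x s| ^ α).aestronglyMeasurable
    · rw [Real.norm_of_nonneg (by positivity)]
      exact abs_fker_rpow_le hα hT hx s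
  have hj : Integrable ((Iic T).indicator fun s => Real.exp (x * s) * Real.exp (-x * T)) :=
    (integrable_indicator_iff measurableSet_Iic).2 ((integrableOn_exp_mul_Iic hx T).mul_const _)
  have h1 := integrable_indicator_one_Ioc 0 T
  refine Eq.trans_le ?_ (integral_mono ((h1.sub (hj.const_mul 2)).const_mul (x ^ (-α))) hf
    (le_abs_fker_rpow hα hα2 hx))
  rw [integral_const_mul]
  simp only [Pi.sub_apply]
  rw [integral_sub h1 (hj.const_mul 2),
    integral_indicator_one_Ioc hT, integral_const_mul, integral_indicator measurableSet_Iic,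
    integral_mul_const, integral_exp_mul_Iic hx, div_mul_eq_mul_div, ← Real.exp_add]
  simp

theorem tendsto_inv_mul_integral_abs_fker_rpow {α τ x : ℝ} (hα : 0 < α) (hα2 : α ≤ 2)
    (hτ : 0 ≤ τ) (hx : 0 < x) :
    Tendsto (fun c : ℝ => c⁻¹ * ∫ s, |fker (c * τ) x s| ^ α) atTop (nhds (τ * x ^ (-α))) := by
  have key : ∀ k : ℝ, Tendsto (fun c : ℝ => x ^ (-α) * (c⁻¹ * k + τ)) atTop
      (nhds (τ * x ^ (-α))) := by
    intro k
    have := ((tendsto_inv_atTop_zero.mul_const k).add_const τ).const_mul (x ^ (-α))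
    rwa [zero_mul, zero_add, mul_comm] at this
  refine tendsto_of_tendsto_of_tendsto_of_le_of_le' (key (-(2 * x⁻¹))) (key (α * x)⁻¹) ?_ ?_ <;>
  filter_upwards [eventually_gt_atTop 0] with c hc
  · calc _ = c⁻¹ * (x ^ (-α) * (c * τ - 2 * x⁻¹)) := by field_simp; ring
      _ ≤ _ := by
        gcongr
        exact le_integral_abs_fker_rpow hα hα2 (by positivity) hx
  · calc _ ≤ c⁻¹ * (x ^ (-α) * ((α * x)⁻¹ + c * τ)) := by
          gcongr
          exact integral_abs_fker_rpow_le hα (by positivity) hx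
      _ = _ := by field_simp

/-- A function equal to `x ^ (β - 1)` near zero and to `C * x ^ (β - 1 - α)` near infinity. -/
noncomputable def rpowEnvelope (α β C x : ℝ) : ℝ :=
  (Ioc 0 1).indicator (fun x => x ^ (β - 1)) x +
    (Ioi 1).indicator (fun x => C * x ^ (β - 1 - α)) x

theorem integrable_rpowEnvelope {α β : ℝ} (hβ : 0 < β) (hβα : β < α) (C : ℝ) :
    Integrable (rpowEnvelope α β C) := by
  refine Integrable.add ((integrable_indicator_iff measurableSet_Ioc).2 ?_)
    ((integrable_indicator_iff measurableSet_Ioi).2 ?_)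
  · rw [← intervalIntegrable_iff_integrableOn_Ioc_of_le zero_le_one]
    exact intervalIntegral.intervalIntegrable_rpow' (by linarith)
  · exact (integrableOn_Ioi_rpow_of_lt (by linarith) one_pos).const_mul C

theorem norm_exp_neg_sub_one_mul_rpow_le {α β C K x : ℝ} (hx : 0 < x) (hK : 0 ≤ K)
    (hKC : 1 < x → K ≤ C * x ^ (-α)) :
    ‖(Real.exp (-K) - 1) * x ^ (β - 1)‖ ≤ rpowEnvelope α β C x := by
  have h1 : Real.exp (-K) ≤ 1 := Real.exp_le_one_iff.2 (by linarith)
  rw [norm_mul, Real.norm_of_nonneg (by positivity : 0 ≤ x ^ (β - 1)), Real.norm_eq_abs,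
    abs_of_nonpos (by linarith)]
  unfold rpowEnvelope
  rcases le_or_gt x 1 with h | h
  · rw [indicator_of_mem (show x ∈ Ioc 0 1 from ⟨hx, h⟩),
      indicator_of_notMem (show x ∉ Ioi 1 from h.not_gt), add_zero]
    exact mul_le_of_le_one_left (by positivity) (by linarith [Real.exp_pos (-K)])
  · rw [indicator_of_notMem (fun hs => h.not_ge hs.2), indicator_of_mem (mem_Ioi.2 h), zero_add,
      sub_eq_add_neg (β - 1), add_comm (β - 1), Real.rpow_add hx, ← mul_assoc]
    gcongr
    linarith [Real.add_one_le_exp (-K), hKC h]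

theorem integral_exp_neg_mul_rpow_neg_sub_one {α β a : ℝ} (hβ : 0 < β) (hβα : β < α)
    (ha : 0 < a) :
    ∫ x in Ioi (0 : ℝ), (Real.exp (-a * x ^ (-α)) - 1) * x ^ (β - 1) =
      -(Real.Gamma (1 - β / α) / β) * a ^ (β / α) := by
  have hα : 0 < α := hβ.trans hβα
  have hγ : 0 < 1 - β / α := by rw [sub_pos, div_lt_one hα]; exact hβα
  set g : ℝ → ℝ := fun y => y ^ ((1 - β / α) - 1) * Real.exp (-(a * y)) with hg
  have hgi : IntegrableOn g (Ioi 0) := by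
    have := integrableOn_rpow_mul_exp_neg_mul_rpow (p := 1) (s := (1 - β / α) - 1) (b := a)
      (by linarith) one_pos ha
    simpa [hg] using this
  have hcomp : ∀ x ∈ Ioi (0 : ℝ), (|-α| * x ^ (-α - 1)) • g (x ^ (-α)) =
      (β / a) * ((Real.exp (-a * x ^ (-α)) * (a * α * x ^ (-α - 1))) * (x ^ β / β)) := by
    intro x hx
    have : (x ^ (-α)) ^ ((1 - β / α) - 1) = x ^ β := by
      rw [← Real.rpow_mul (le_of_lt hx)]
      congr 1
      field_simp
      ring
    simp only [hg, smul_eq_mul, this, abs_neg, abs_of_pos hα, neg_mul]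
    field_simp
  have hu : ∀ x ∈ Ioi (0 : ℝ), HasDerivAt (fun x => Real.exp (-a * x ^ (-α)) - 1)
      (Real.exp (-a * x ^ (-α)) * (a * α * x ^ (-α - 1))) x := by
    intro x hx
    have h := (((Real.hasDerivAt_rpow_const (p := -α) (Or.inl (ne_of_gt hx))).const_mul
      (-a)).exp).sub_const 1
    exact h.congr_deriv (by ring)
  have hv : ∀ x ∈ Ioi (0 : ℝ), HasDerivAt (fun x => x ^ β / β) (x ^ (β - 1)) x := by
    intro x hx
    have h := (Real.hasDerivAt_rpow_const (p := β) (Or.inl (ne_of_gt hx))).div_const β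
    exact h.congr_deriv (by field_simp)
  have hright : IntegrableOn ((fun x => Real.exp (-a * x ^ (-α)) - 1) * fun x => x ^ (β - 1))
      (Ioi 0) := by
    refine Integrable.mono' (integrable_rpowEnvelope hβ hβα a).integrableOn
      (Measurable.aestronglyMeasurable (by fun_prop)) ?_
    filter_upwards [ae_restrict_mem measurableSet_Ioi] with x hx
    have hx' : 0 < x := hx
    rw [Pi.mul_apply, neg_mul]
    exact norm_exp_neg_sub_one_mul_rpow_le hx' (by positivity) fun _ => le_rfl
  have hleft : IntegrableOn ((fun x => Real.exp (-a * x ^ (-α)) * (a * α * x ^ (-α - 1))) *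
      fun x => x ^ β / β) (Ioi 0) := by
    have h := ((integrableOn_Ioi_comp_rpow_iff g (neg_ne_zero.2 hα.ne')).2 hgi).const_mul (a / β)
    refine IntegrableOn.congr_fun h (fun x hx => ?_) measurableSet_Ioi
    simp only [hcomp x hx, Pi.mul_apply]
    field_simp
  have hbd : ∀ x : ℝ, 0 < x → |Real.exp (-a * x ^ (-α)) - 1| ≤ min 1 (a * x ^ (-α)) := by
    intro x hx
    have h0 : 0 < a * x ^ (-α) := by positivity
    have h1 : Real.exp (-a * x ^ (-α)) ≤ 1 := Real.exp_le_one_iff.2 (by linarith)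
    rw [abs_of_nonpos (by linarith)]
    exact le_min (by linarith [Real.exp_pos (-a * x ^ (-α))])
      (by linarith [Real.add_one_le_exp (-a * x ^ (-α))])
  have h0 : Tendsto ((fun x => Real.exp (-a * x ^ (-α)) - 1) * fun x => x ^ β / β)
      (nhdsWithin 0 (Ioi 0)) (nhds 0) := by
    have hl : Tendsto (fun x : ℝ => x ^ β / β) (nhdsWithin 0 (Ioi 0)) (nhds 0) := by
      have := ((Real.continuousAt_rpow_const 0 β (Or.inr hβ.le)).tendsto.div_const β)
      rw [Real.zero_rpow hβ.ne', zero_div] at this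
      exact this.mono_left nhdsWithin_le_nhds
    refine squeeze_zero_norm' ?_ hl
    filter_upwards [self_mem_nhdsWithin] with x hx
    have hx' : 0 < x := hx
    rw [Pi.mul_apply, norm_mul, Real.norm_of_nonneg (by positivity : 0 ≤ x ^ β / β)]
    exact mul_le_of_le_one_left (by positivity) ((hbd x hx).trans (min_le_left _ _))
  have htop : Tendsto ((fun x => Real.exp (-a * x ^ (-α)) - 1) * fun x => x ^ β / β)
      atTop (nhds 0) := by
    have hl : Tendsto (fun x : ℝ => a / β * x ^ (-(α - β))) atTop (nhds 0) := by
      simpa using (tendsto_rpow_neg_atTop (sub_pos.2 hβα)).const_mul (a / β)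
    refine squeeze_zero_norm' ?_ hl
    filter_upwards [eventually_gt_atTop 0] with x hx
    rw [Pi.mul_apply, norm_mul, Real.norm_of_nonneg (by positivity : 0 ≤ x ^ β / β)]
    calc _ ≤ a * x ^ (-α) * (x ^ β / β) := by
          gcongr
          exact (hbd x hx).trans (min_le_right _ _)
      _ = _ := by
          rw [neg_sub, sub_eq_add_neg, add_comm, Real.rpow_add hx]
          ring
  have hibp := integral_Ioi_mul_deriv_eq_deriv_mul hu hv hright hleft h0 htop
  have hsub := integral_comp_rpow_Ioi g (neg_ne_zero.2 hα.ne')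
  rw [setIntegral_congr_fun measurableSet_Ioi hcomp, integral_const_mul, hg,
    Real.integral_rpow_mul_exp_neg_mul_Ioi hγ ha] at hsub
  have hpow : (1 / a) ^ (1 - β / α) * a = a ^ (β / α) := by
    rw [one_div, Real.inv_rpow ha.le, ← Real.rpow_neg ha.le, neg_sub, Real.rpow_sub_one ha.ne']
    field_simp
  rw [hibp, ← hpow]
  have hsub' : ∀ I : ℝ, β / a * I = (1 / a) ^ (1 - β / α) * Real.Gamma (1 - β / α) →
      0 - 0 - I = -(Real.Gamma (1 - β / α) / β) * ((1 / a) ^ (1 - β / α) * a) := by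
    intro I hI
    field_simp at hI ⊢
    linarith
  exact hsub' _ hsub

/-- the large-scale asymptotic self-similarity limit of `Z_{α,β}`
towards the sub-stable process `W_{α,β}` (Proposition 3.1(v), case `c → ∞`),
at the level of characteristic exponents with `ω ≡ 1`: with
`K_c(x) := c^{−1} ∫_ℝ |f_{cτ}(x,s)|^α ds`,
`lim_{c→∞} ∫_0^∞ (e^{−rK_c(x)} − 1)x^{β−1} dx = ∫_0^∞ (e^{−rτx^{−α}} − 1)x^{β−1} dx
  = −(Γ(1−β/α)/β)(rτ)^{β/α}`. -/
theorem stmt_13 (α β τ r : ℝ) (hβ0 : 0 < β) (hβα : β < α) (hα2 : α ≤ 2)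
    (hτ : 0 < τ) (hr : 0 < r) :
    Filter.Tendsto (fun c : ℝ =>
        ∫ x in Set.Ioi (0:ℝ),
          (Real.exp (-r * (c⁻¹ * ∫ s : ℝ, |fker (c * τ) x s| ^ α)) - 1) * x ^ (β - 1))
      Filter.atTop
      (nhds (∫ x in Set.Ioi (0:ℝ),
        (Real.exp (-r * τ * x ^ (-α)) - 1) * x ^ (β - 1))) ∧
    (∫ x in Set.Ioi (0:ℝ), (Real.exp (-r * τ * x ^ (-α)) - 1) * x ^ (β - 1))
      = -(Real.Gamma (1 - β / α) / β) * (r * τ) ^ (β / α) := by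
  have hα : 0 < α := hβ0.trans hβα
  refine ⟨?_, ?_⟩
  · refine tendsto_integral_filter_of_dominated_convergence
      (rpowEnvelope α β (r * (α⁻¹ + τ))) (Eventually.of_forall fun c => ?_) ?_
      (integrable_rpowEnvelope hβ0 hβα _).integrableOn ?_
    · have hm : Measurable fun x : ℝ => ∫ s : ℝ, |fker (c * τ) x s| ^ α := by
        refine (StronglyMeasurable.integral_prod_right (ν := volume)
          (f := fun x s : ℝ => |fker (c * τ) x s| ^ α)
          (Measurable.stronglyMeasurable ?_)).measurable
        have := measurable_fker (c * τ)
        exact (this.norm.pow_const α)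
      exact Measurable.aestronglyMeasurable (by fun_prop)
    · filter_upwards [eventually_ge_atTop 1] with c hc
      filter_upwards [ae_restrict_mem measurableSet_Ioi] with x hx
      have hx' : 0 < x := hx
      have hc' : 0 < c := one_pos.trans_le hc
      rw [neg_mul]
      refine norm_exp_neg_sub_one_mul_rpow_le hx'
        (mul_nonneg hr.le (mul_nonneg (by positivity) (integral_nonneg fun s => by positivity)))
        fun h1 => ?_
      calc _ ≤ r * (c⁻¹ * (x ^ (-α) * ((α * x)⁻¹ + c * τ))) := by
            gcongr
            exact integral_abs_fker_rpow_le hα (by positivity) hx'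
        _ = r * ((α⁻¹ * (c * x)⁻¹ + τ) * x ^ (-α)) := by field_simp
        _ ≤ r * ((α⁻¹ * 1 + τ) * x ^ (-α)) := by
            gcongr
            exact inv_le_one_of_one_le₀ (one_le_mul_of_one_le_of_one_le hc h1.le)
        _ = _ := by ring
    · filter_upwards [ae_restrict_mem measurableSet_Ioi] with x hx
      have h := ((tendsto_inv_mul_integral_abs_fker_rpow hα hα2 hτ.le hx).const_mul (-r))
      rw [← mul_assoc] at h
      exact (((Real.continuous_exp.tendsto _).comp h).sub_const 1).mul_const _
  · simpa only [neg_mul] using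
      integral_exp_neg_mul_rpow_neg_sub_one hβ0 hβα (mul_pos hr hτ)
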